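/- Let K ⊆ W and let ρ : S → End_F(V_K) be a map satisfying the braid relations of (W,S) (for all distinct s,t ∈ S with m(s,t) < ∞: ρ_sρ_tρ_s⋯ = ρ_tρ_sρ_t⋯, with m(s,t) factors on each side) and Axiom (A), and suppose the pair (ρ,K) is minimal. If a_s(w) = a_{s'}(w') implies b_s(w) = b_{s'}(w') for all s,s' ∈ S and w,w' ∈ K, then ρ satisfies Axiom (B): there exist scalars ȧ_t, ḃ_t, ä_t, b̈_t ∈ F indexed by the reflections t ∈ T such that for all s ∈ S and w ∈ K, (a_s(w), b_s(w)) = (ȧ_{wsw⁻¹}, ḃ_{wsw⁻¹}) if ℓ(w) < ℓ(ws), and (a_s(w), b_s(w)) = (ä_{wsw⁻¹}, b̈_{wsw⁻¹}) if ℓ(w) > ℓ(ws). -/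

import Mathlib

open CoxeterSystem

variable {B W : Type*} [Group W] {M : CoxeterMatrix B}

/-- The basis vector `C_w` of the vector space `V_K` spanned by `{C_w : w ∈ K}`,
realized as finitely supported functions on the subtype `K`. -/
noncomputable def Cvec (F : Type*) [Field F] (K : Set W) (w : W) (hw : w ∈ K) : ↥K →₀ F :=
  Finsupp.single ⟨w, hw⟩ 1

/-- A map `ρ : S → End_F(V_K)` satisfying Axiom (A), with coefficient data `a, b`. -/
structure AYMap (cs : CoxeterSystem M W) (F : Type*) [Field F] (K : Set W) where
  ρ : B → Module.End F (↥K →₀ F)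
  a : B → W → F
  b : B → W → F
  axiomA_mem : ∀ (i : B) (w : W) (hw : w ∈ K) (h : w * cs.simple i ∈ K),
    ρ i (Cvec F K w hw) =
      a i w • Cvec F K w hw + b i w • Cvec F K (w * cs.simple i) h
  axiomA_not_mem : ∀ (i : B) (w : W) (hw : w ∈ K), w * cs.simple i ∉ K →
    ρ i (Cvec F K w hw) = a i w • Cvec F K w hw
  b_eq_zero : ∀ (i : B) (w : W), w ∈ K → w * cs.simple i ∉ K → b i w = 0

/-- The alternating product `x y x y ⋯` with `m` factors, starting with `x`. -/
def altProd {E : Type*} [Monoid E] (x y : E) : ℕ → E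
  | 0 => 1
  | n + 1 => x * altProd y x n

/-- The map `ρ` satisfies the braid relations of `(W,S)`: for distinct `s, t ∈ S` with
`m(s,t) < ∞` (recorded as `M s t ≠ 0`), `ρ_s ρ_t ρ_s ⋯ = ρ_t ρ_s ρ_t ⋯`
(`m(s,t)` factors on each side). -/
def BraidRels {F : Type*} [Field F] {K : Set W} (M : CoxeterMatrix B)
    (ρ : B → Module.End F (↥K →₀ F)) : Prop :=
  ∀ i j : B, i ≠ j → M i j ≠ 0 → altProd (ρ i) (ρ j) (M i j) = altProd (ρ j) (ρ i) (M i j)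

/-- The span of `{C_w : w ∈ K'}` inside `V_K`. -/
noncomputable def spanOf (F : Type*) [Field F] (K : Set W) (K' : Set W) :
    Submodule F (↥K →₀ F) :=
  Submodule.span F {x | ∃ (w : W) (h : w ∈ K), w ∈ K' ∧ x = Cvec F K w h}

/-- Minimality of the pair `(ρ, K)`: `K` is nonempty and has no proper nonempty subset
`K'` such that `span{C_w : w ∈ K'}` is invariant under every `ρ_s`. -/
def AYMap.Minimal {cs : CoxeterSystem M W} {F : Type*} [Field F] {K : Set W}
    (P : AYMap cs F K) : Prop :=
  K.Nonempty ∧ ∀ K' : Set W, K' ⊆ K → K'.Nonempty →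
    (∀ (i : B), ∀ x ∈ spanOf F K K', P.ρ i x ∈ spanOf F K K') → K' = K

namespace CoxeterSystem

/-- The word of length `n` alternating between `i` and `j`, starting with `i`. -/
def altList (i j : B) : ℕ → List B
  | 0 => []
  | n + 1 => i :: altList j i n

@[simp]
theorem length_altList (i j : B) (n : ℕ) : (altList i j n).length = n := by
  induction n generalizing i j with
  | zero => rfl
  | succ n ih => simp [altList, ih]

theorem altList_succ' (i j : B) (n : ℕ) :
    altList i j (n + 1) = altList i j n ++ [if Even n then i else j] := by
  induction n generalizing i j with
  | zero => simp [altList]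
  | succ n ih =>
    rw [altList, ih j i, altList]
    by_cases h : Even n <;> simp [h, Nat.even_add_one]

theorem reverse_altList_two_mul (i j : B) (n : ℕ) :
    (altList i j (2 * n)).reverse = altList j i (2 * n) := by
  induction n with
  | zero => rfl
  | succ n ih =>
    rw [Nat.mul_succ, altList_succ' i j, altList_succ' i j]
    simp [ih, altList]

theorem functionEnd_mul_apply {α : Type*} (f g : Function.End α) (x : α) :
    (f * g) x = f (g x) := rfl

section StrongExchange

variable (cs : CoxeterSystem M W)

theorem leftInvSeq_altList (i j : B) (n : ℕ) :
    cs.leftInvSeq (altList i j n) =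
      (List.range n).map fun k ↦ (cs.simple i * cs.simple j) ^ k * cs.simple i := by
  induction n generalizing i j with
  | zero => rfl
  | succ n ih =>
    rw [altList, leftInvSeq, ih, List.range_succ_eq_map]
    simp only [List.map_map, List.map_cons, pow_zero, one_mul, List.cons.injEq, true_and]
    refine List.map_congr_left fun k hk ↦ ?_
    clear hk
    have h : cs.simple i * (cs.simple j * cs.simple i) ^ k =
        (cs.simple i * cs.simple j) ^ k * cs.simple i := by
      induction k with
      | zero => simp
      | succ k ihk => rw [pow_succ, ← mul_assoc, ihk, pow_succ]; simp only [mul_assoc]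
    simp only [Function.comp_apply, MulAut.conj_apply, inv_simple, Nat.succ_eq_add_one]
    rw [← mul_assoc, h, pow_succ]
    simp only [mul_assoc]

open scoped Classical in
/-- The action of a simple generator on pairs consisting of an element of `W` and a sign:
conjugate the element, and flip the sign when it equals the generator. -/
noncomputable def signedConj (i : B) (p : W × ZMod 2) : W × ZMod 2 :=
  (cs.simple i * p.1 * cs.simple i, p.2 + if p.1 = cs.simple i then 1 else 0)

/-- `signedConj` as an element of the monoid of self-maps. -/
noncomputable def signedConjEnd (i : B) : Function.End (W × ZMod 2) := cs.signedConj i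

open scoped Classical in
theorem prod_map_signedConjEnd (ω : List B) (p : W × ZMod 2) :
    (ω.map cs.signedConjEnd).prod p =
      (cs.wordProd ω * p.1 * (cs.wordProd ω)⁻¹,
        p.2 + ((cs.rightInvSeq ω).count p.1 : ZMod 2)) := by
  induction ω with
  | nil => simp [Function.End.one_def]
  | cons i ω ih =>
    rw [List.map_cons, List.prod_cons, functionEnd_mul_apply, ih]
    simp only [signedConjEnd, signedConj, wordProd_cons, rightInvSeq, List.count_cons, mul_inv_rev,
      inv_simple, Prod.mk.injEq]
    refine ⟨by simp only [mul_assoc], ?_⟩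
    have h : cs.wordProd ω * p.1 * (cs.wordProd ω)⁻¹ = cs.simple i ↔
        (cs.wordProd ω)⁻¹ * cs.simple i * cs.wordProd ω = p.1 := by
      constructor <;> intro h
      · rw [← h]; group
      · rw [← h]; group
    by_cases h' : (cs.wordProd ω)⁻¹ * cs.simple i * cs.wordProd ω = p.1
    · simp [h.2 h', h', add_assoc]
    · simp [h', mt h.1 h']

theorem isLiftable_signedConjEnd : M.IsLiftable cs.signedConjEnd := by
  classical
  intro i j
  have h : ∀ n : ℕ, (cs.signedConjEnd i * cs.signedConjEnd j) ^ n =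
      ((altList i j (2 * n)).map cs.signedConjEnd).prod := by
    intro n
    induction n with
    | zero => rfl
    | succ n ih => rw [pow_succ', ih, Nat.mul_succ]; simp [altList, mul_assoc]
  have h' : ∀ n : ℕ, (cs.simple i * cs.simple j) ^ n = cs.wordProd (altList i j (2 * n)) := by
    intro n
    induction n with
    | zero => simp [altList]
    | succ n ih => rw [pow_succ', ih, Nat.mul_succ]; simp [altList, wordProd_cons, mul_assoc]
  refine funext fun p ↦ ?_
  rw [h, prod_map_signedConjEnd, ← h', simple_mul_simple_pow, ← List.count_reverse,
    ← leftInvSeq_reverse, reverse_altList_two_mul, leftInvSeq_altList, two_mul, List.range_add]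
  have h2 : ((fun k ↦ (cs.simple j * cs.simple i) ^ k * cs.simple j) ∘ fun x ↦ M i j + x) =
      fun k ↦ (cs.simple j * cs.simple i) ^ k * cs.simple j := by
    ext k
    simp [pow_add]
  rw [List.map_append, List.map_map, h2, List.count_append]
  simp [CharTwo.add_self_eq_zero, Function.End.one_def]

/-- The parity of the number of occurrences of `t` in the right inversion sequence of any word
for `w`. -/
noncomputable def invParity (w t : W) : ZMod 2 :=
  (cs.lift ⟨cs.signedConjEnd, cs.isLiftable_signedConjEnd⟩ w (t, 0)).2

theorem lift_signedConjEnd_wordProd (ω : List B) :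
    cs.lift ⟨cs.signedConjEnd, cs.isLiftable_signedConjEnd⟩ (cs.wordProd ω) =
      (ω.map cs.signedConjEnd).prod := by
  rw [wordProd, map_list_prod, List.map_map]
  congr 1
  refine List.map_congr_left fun i _ ↦ ?_
  simp only [Function.comp_apply]
  exact cs.lift_apply_simple _ i

open scoped Classical in
theorem invParity_wordProd (ω : List B) (t : W) :
    cs.invParity (cs.wordProd ω) t = ((cs.rightInvSeq ω).count t : ZMod 2) := by
  rw [invParity, lift_signedConjEnd_wordProd, prod_map_signedConjEnd]
  simp

theorem lift_signedConjEnd_apply (w t : W) (ε : ZMod 2) :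
    cs.lift ⟨cs.signedConjEnd, cs.isLiftable_signedConjEnd⟩ w (t, ε) =
      (w * t * w⁻¹, ε + cs.invParity w t) := by
  classical
  obtain ⟨ω, rfl⟩ := cs.wordProd_surjective w
  rw [invParity_wordProd, lift_signedConjEnd_wordProd, prod_map_signedConjEnd]

theorem invParity_mul (x y t : W) :
    cs.invParity (x * y) t = cs.invParity y t + cs.invParity x (y * t * y⁻¹) := by
  have h := cs.lift_signedConjEnd_apply (x * y) t 0
  rw [map_mul, functionEnd_mul_apply, lift_signedConjEnd_apply,
    lift_signedConjEnd_apply] at h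
  simpa using (congrArg Prod.snd h).symm

theorem invParity_one (t : W) : cs.invParity 1 t = 0 := by
  classical
  simpa using cs.invParity_wordProd [] t

theorem invParity_simple_self (i : B) : cs.invParity (cs.simple i) (cs.simple i) = 1 := by
  classical
  simpa using cs.invParity_wordProd [i] (cs.simple i)

theorem IsReflection.invParity_self {cs : CoxeterSystem M W} {t : W} (ht : cs.IsReflection t) :
    cs.invParity t t = 1 := by
  obtain ⟨u, i, rfl⟩ := ht
  have h := cs.invParity_mul u⁻¹ u (cs.simple i)
  rw [inv_mul_cancel, invParity_one] at h
  rw [invParity_mul, invParity_mul]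
  have h1 : u⁻¹ * (u * cs.simple i * u⁻¹) * u⁻¹⁻¹ = cs.simple i := by group
  rw [h1, invParity_simple_self]
  have h2 : cs.simple i * cs.simple i * (cs.simple i)⁻¹ = cs.simple i := by simp
  rw [h2]
  linear_combination -h

theorem IsReflection.invParity_eq_one_iff {cs : CoxeterSystem M W} {t : W}
    (ht : cs.IsReflection t) (w : W) :
    cs.invParity w t = 1 ↔ cs.length (w * t) < cs.length w := by
  classical
  have key : ∀ v : W, cs.invParity v t = 1 → cs.length (v * t) < cs.length v := by
    intro v hv
    obtain ⟨ω, hω, rfl⟩ := cs.exists_isReduced v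
    rw [invParity_wordProd] at hv
    refine (cs.isRightInversion_of_mem_rightInvSeq hω ?_).2
    by_contra h
    rw [List.count_eq_zero_of_not_mem h] at hv
    simp at hv
  refine ⟨key w, fun h ↦ ?_⟩
  by_contra h0
  have h1 : cs.invParity (w * t) t = 1 := by
    rw [invParity_mul, ht.invParity_self, ht.inv]
    rw [ht.mul_self, one_mul]
    generalize cs.invParity w t = x at h0
    revert h0 x
    decide
  have h2 := key _ h1
  rw [mul_assoc, ht.mul_self, mul_one] at h2
  lia

theorem mem_leftInvSeq_of_isLeftDescent {ω : List B} {i : B}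
    (h : cs.IsLeftDescent (cs.wordProd ω) i) : cs.simple i ∈ cs.leftInvSeq ω := by
  classical
  rw [← List.mem_reverse, ← rightInvSeq_reverse]
  have h1 : cs.invParity (cs.wordProd ω.reverse) (cs.simple i) = 1 := by
    rw [(cs.isReflection_simple i).invParity_eq_one_iff, wordProd_reverse]
    exact cs.isRightDescent_inv_iff.2 h
  rw [invParity_wordProd] at h1
  by_contra h2
  rw [List.count_eq_zero_of_not_mem h2] at h1
  simp at h1

/-- The exchange property. -/
theorem exists_simple_mul_wordProd_eq_eraseIdx {ω : List B} {i : B}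
    (h : cs.IsLeftDescent (cs.wordProd ω) i) :
    ∃ k < ω.length, cs.simple i * cs.wordProd ω = cs.wordProd (ω.eraseIdx k) := by
  obtain ⟨k, hk, hk'⟩ := List.mem_iff_getElem.1 (cs.mem_leftInvSeq_of_isLeftDescent h)
  refine ⟨k, by simpa using hk, ?_⟩
  rw [← getD_leftInvSeq_mul_wordProd, List.getD_eq_getElem _ _ hk, hk']

theorem isReduced_of_nodup_leftInvSeq {ω : List B} (h : (cs.leftInvSeq ω).Nodup) :
    cs.IsReduced ω := by
  classical
  rw [← isReduced_reverse_iff]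
  rw [← List.nodup_reverse, ← rightInvSeq_reverse] at h
  generalize ω.reverse = ω at h
  obtain ⟨ω', hω', h'⟩ := cs.exists_isReduced (cs.wordProd ω)
  have hsub : cs.rightInvSeq ω ⊆ cs.rightInvSeq ω' := by
    intro t ht
    have h1 := cs.invParity_wordProd ω t
    rw [h', invParity_wordProd, List.count_eq_one_of_mem h ht] at h1
    by_contra h2
    rw [List.count_eq_zero_of_not_mem h2] at h1
    simp at h1
  have h2 := (List.subperm_of_subset h hsub).length_le
  simp only [length_rightInvSeq] at h2
  refine le_antisymm (cs.length_wordProd_le ω) ?_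
  rw [h', hω'.eq]
  exact h2

end StrongExchange
end CoxeterSystem
namespace CoxeterMatrix

open Real Polynomial.Chebyshev Module

variable (M)

/-- The coroots of the geometric representation, as linear forms on the span of the simple roots. -/
noncomputable def geomCoroot (i : B) : Dual ℝ (B →₀ ℝ) :=
  Finsupp.linearCombination ℝ fun j ↦ -2 * cos (π / M i j)

@[simp]
theorem geomCoroot_single (i j : B) :
    M.geomCoroot i (Finsupp.single j 1) = -2 * cos (π / M i j) := by
  simp [geomCoroot]

theorem geomCoroot_self (i : B) : M.geomCoroot i (Finsupp.single i 1) = 2 := by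
  simp

/-- The simple reflections of the geometric representation. -/
noncomputable def geomReflection (i : B) : (B →₀ ℝ) ≃ₗ[ℝ] (B →₀ ℝ) :=
  reflection (M.geomCoroot_self i)

theorem two_mul_cos_two_pi_div (i j : B) :
    2 * cos (2 * π / M i j) =
      M.geomCoroot i (Finsupp.single j 1) * M.geomCoroot j (Finsupp.single i 1) - 2 := by
  rw [geomCoroot_single, geomCoroot_single, M.symmetric j i, mul_div_assoc, cos_two_mul]
  ring

theorem sin_two_pi_div_pos {m : ℕ} (hm : 3 ≤ m) : 0 < sin (2 * π / m) := by
  have h : (3 : ℝ) ≤ m := by exact_mod_cast hm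
  apply sin_pos_of_pos_of_lt_pi
  · have := pi_pos
    positivity
  · rw [div_lt_iff₀ (by linarith)]
    nlinarith [pi_pos]

theorem isLiftable_geomReflection : M.IsLiftable M.geomReflection := by
  intro i j
  rcases eq_or_ne (M i j) 0 with h0 | h0
  · rw [h0, pow_zero]
  rcases eq_or_ne i j with rfl | hij
  · rw [M.diagonal, pow_one]
    exact LinearEquiv.ext fun v ↦ involutive_reflection (M.geomCoroot_self i) v
  have h1 : M i j ≠ 1 := M.off_diagonal i j hij
  apply LinearEquiv.toLinearMap_injective
  apply LinearMap.ext
  intro v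
  change ((reflection (M.geomCoroot_self i) * reflection (M.geomCoroot_self j)) ^ (M i j)) v = v
  rw [reflection_mul_reflection_pow_apply _ _ _ _ (2 * cos (2 * π / M i j))
    (M.two_mul_cos_two_pi_div i j)]
  rcases eq_or_ne (M i j) 2 with h2 | h2
  · simp only [geomCoroot_single, M.symmetric j i, h2]
    norm_num
    module
  have hs := sin_two_pi_div_pos (m := M i j) (by lia)
  have hS := S_two_mul_real_cos (2 * π / M i j)
  have hm : (M i j : ℝ) * (2 * π / M i j) = 2 * π := by
    field_simp
  generalize 2 * π / (M i j : ℝ) = θ at hs hS hm ⊢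
  rcases Nat.even_or_odd' (M i j) with ⟨k, hk | hk⟩
  · have e1 : ((M i j : ℤ) - 2) / 2 = k - 1 := by lia
    have e2 : ((M i j : ℤ) - 1) / 2 = k - 1 := by lia
    have hz : (S ℝ (k - 1)).eval (2 * cos θ) = 0 := by
      have h := hS (k - 1)
      have e : (((k - 1 : ℤ) : ℝ) + 1) * θ = π := by
        rw [hk] at hm
        push_cast at hm ⊢
        linarith
      rw [e, sin_pi] at h
      exact (mul_eq_zero.1 h).resolve_right hs.ne'
    rw [e1, e2, hz]
    simp
  · have e1 : ((M i j : ℤ) - 2) / 2 = k - 1 := by lia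
    have e2 : ((M i j : ℤ) - 1) / 2 = k := by lia
    have e3 : ((M i j : ℤ) - 3) / 2 = k - 1 := by lia
    have e4 : (M i j : ℤ) / 2 = k := by lia
    have hz : (S ℝ k).eval (2 * cos θ) + (S ℝ (k - 1)).eval (2 * cos θ) = 0 := by
      have h := hS (k - 1)
      have h' := hS k
      have e : ((k : ℤ) + 1 : ℝ) * θ = 2 * π - (((k - 1 : ℤ) : ℝ) + 1) * θ := by
        rw [hk] at hm
        push_cast at hm ⊢
        linarith
      rw [e, sin_two_pi_sub] at h'
      have h'' : ((S ℝ k).eval (2 * cos θ) + (S ℝ (k - 1)).eval (2 * cos θ)) * sin θ = 0 := by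
        rw [add_mul, h, h', neg_add_cancel]
      exact (mul_eq_zero.1 h'').resolve_right hs.ne'
    rw [e1, e2, e3, e4, hz]
    simp

theorem geomReflection_mul_pow_ne_one {i j : B} (hij : i ≠ j) {k : ℕ} (hk : k ≠ 0)
    (hkm : M i j = 0 ∨ k < M i j) :
    (M.geomReflection i * M.geomReflection j) ^ k ≠ 1 := by
  intro h
  have h1 : M i j ≠ 1 := M.off_diagonal i j hij
  have hg : M.geomCoroot j (Finsupp.single i 1) = -2 * cos (π / M i j) := by
    rw [geomCoroot_single, M.symmetric j i]
  have hx := congrArg (fun e : (B →₀ ℝ) ≃ₗ[ℝ] (B →₀ ℝ) ↦ e (Finsupp.single i 1)) h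
  change ((reflection (M.geomCoroot_self i) * reflection (M.geomCoroot_self j)) ^ k)
    (Finsupp.single i 1) = Finsupp.single i 1 at hx
  rw [reflection_mul_reflection_pow_apply_self _ _ _ (2 * cos (2 * π / M i j))
    (M.two_mul_cos_two_pi_div i j), hg] at hx
  have hxi := DFunLike.congr_fun hx i
  have hxj := DFunLike.congr_fun hx j
  simp only [Finsupp.coe_add, Finsupp.coe_smul, Pi.add_apply, Pi.smul_apply,
    Finsupp.single_eq_same, Finsupp.single_eq_of_ne hij, Finsupp.single_eq_of_ne hij.symm,
    smul_eq_mul, mul_one, mul_zero, add_zero, zero_add] at hxi hxj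
  rcases eq_or_ne (M i j) 0 with h0 | h0
  · simp [h0, hk] at hxj
  rcases eq_or_ne (M i j) 2 with h2 | h2
  · obtain rfl : k = 1 := by lia
    simp only [h2] at hxi
    norm_num at hxi
  have hs := sin_two_pi_div_pos (m := M i j) (by lia)
  have hS := S_two_mul_real_cos (2 * π / M i j)
  have hc : cos (π / M i j) ≠ 0 := by
    intro hc
    rw [mul_div_assoc, sin_two_mul, hc] at hs
    simp at hs
  have hz : (S ℝ (k - 1)).eval (2 * cos (2 * π / M i j)) = 0 := by
    simpa [hc] using hxj
  rw [hz, add_zero] at hxi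
  have h3 := hS k
  have h4 := hS (k - 1)
  rw [hz, zero_mul] at h4
  rw [hxi, one_mul] at h3
  push_cast at h3 h4
  rw [sub_add_cancel] at h4
  rw [add_mul, sin_add, ← h4, zero_mul, zero_add, one_mul] at h3
  have h5 : cos (k * (2 * π / M i j)) = 1 :=
    mul_right_cancel₀ hs.ne' (by rw [← h3, one_mul])
  obtain ⟨n, hn⟩ := (cos_eq_one_iff _).1 h5
  have hm0 : (M i j : ℝ) ≠ 0 := by exact_mod_cast h0
  have h6 : (n * M i j : ℝ) = k := by
    field_simp at hn
    linarith
  have h7 : n * (M i j : ℤ) = k := by exact_mod_cast h6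
  have h8 : M i j ∣ k := by
    exact_mod_cast Dvd.intro_left n h7
  exact absurd (Nat.le_of_dvd (Nat.pos_of_ne_zero hk) h8) (by lia)

end CoxeterMatrix

namespace CoxeterSystem

section Dihedral

variable (cs : CoxeterSystem M W)

theorem simple_mul_simple_pow_ne_one {i j : B} (hij : i ≠ j) {k : ℕ} (hk : k ≠ 0)
    (hkm : M i j = 0 ∨ k < M i j) : (cs.simple i * cs.simple j) ^ k ≠ 1 := by
  intro h
  apply M.geomReflection_mul_pow_ne_one hij hk hkm
  have h' := congrArg (cs.lift ⟨M.geomReflection, M.isLiftable_geomReflection⟩) h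
  rw [map_pow, map_mul, map_one] at h'
  erw [cs.lift_apply_simple, cs.lift_apply_simple] at h'
  exact h'

theorem isReduced_altList {i j : B} (hij : i ≠ j) {n : ℕ} (hn : M i j = 0 ∨ n ≤ M i j) :
    cs.IsReduced (altList i j n) := by
  apply isReduced_of_nodup_leftInvSeq
  rw [leftInvSeq_altList]
  refine (List.nodup_map_iff_inj_on List.nodup_range).2 fun a ha b hb hab ↦ ?_
  rw [List.mem_range] at ha hb
  have key : ∀ a b : ℕ, a < n → b < n →
      (cs.simple i * cs.simple j) ^ a = (cs.simple i * cs.simple j) ^ b → ¬ a < b := by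
    intro a b _ _ h hlt
    refine cs.simple_mul_simple_pow_ne_one hij (k := b - a) (by lia) (by lia) ?_
    rw [pow_sub _ hlt.le, h, mul_inv_cancel]
  have h := mul_right_cancel hab
  have h1 := key a b ha hb h
  have h2 := key b a hb ha h.symm
  lia

theorem simple_injective : Function.Injective cs.simple := by
  intro i j h
  by_contra hij
  refine cs.simple_mul_simple_pow_ne_one hij (k := 1) one_ne_zero ?_ ?_
  · have := M.off_diagonal i j hij
    lia
  · simp [h]

theorem exists_altList_append {g : W} (n : ℕ) {i j : B} (hij : i ≠ j)
    (hn : M i j = 0 ∨ n ≤ M i j) (hi : cs.IsLeftDescent g i) (hj : cs.IsLeftDescent g j) :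
    ∃ ξ, g = cs.wordProd (altList i j n ++ ξ) ∧ cs.IsReduced (altList i j n ++ ξ) := by
  induction n generalizing i j with
  | zero =>
    obtain ⟨ω, hω, h⟩ := cs.exists_isReduced g
    exact ⟨ω, h, hω⟩
  | succ n ih =>
    have hsymm := M.symmetric i j
    obtain ⟨ξ, hg, hξ⟩ := ih hij.symm (by lia) hj hi
    have hi' := hi
    rw [hg] at hi'
    obtain ⟨k, hk, hk'⟩ := cs.exists_simple_mul_wordProd_eq_eraseIdx hi'
    have hlen := hξ.eq
    rw [← hg] at hlen
    rw [List.length_append, length_altList] at hk hlen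
    rcases lt_or_ge k n with hkn | hkn
    · exfalso
      rw [List.eraseIdx_append_of_lt_length (by simpa using hkn), wordProd_append, wordProd_append,
        ← mul_assoc] at hk'
      have h1 := mul_right_cancel hk'
      rw [← wordProd_cons] at h1
      have h2 := (cs.isReduced_altList hij hn).eq
      rw [altList, h1] at h2
      have h3 := cs.length_wordProd_le ((altList j i n).eraseIdx k)
      rw [List.length_eraseIdx_of_lt (by simpa using hkn)] at h3
      simp only [List.length_cons, length_altList] at h2 h3
      lia
    · rw [List.eraseIdx_append_of_length_le (by simpa using hkn), ← hg] at hk'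
      have hg' : g = cs.wordProd (altList i j (n + 1) ++ ξ.eraseIdx (k - n)) := by
        rw [altList, List.cons_append, wordProd_cons]
        simp only [length_altList] at hk'
        rw [← hk', simple_mul_simple_cancel_left]
      refine ⟨_, hg', ?_⟩
      rw [IsReduced, ← hg', hlen, List.length_append, length_altList,
        List.length_eraseIdx_of_lt (by lia)]
      lia

theorem coxeterMatrix_ne_zero_of_isLeftDescent {g : W} {i j : B} (hij : i ≠ j)
    (hi : cs.IsLeftDescent g i) (hj : cs.IsLeftDescent g j) : M i j ≠ 0 := by
  intro h0
  obtain ⟨ξ, hg, hξ⟩ := cs.exists_altList_append (cs.length g + 1) hij (.inl h0) hi hj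
  have h := hξ.eq
  rw [← hg, List.length_append, length_altList] at h
  lia

theorem wordProd_altList_eq (i j : B) :
    cs.wordProd (altList i j (M i j)) = cs.wordProd (altList j i (M i j)) := by
  have h : ∀ (i j : B) (n : ℕ), (altList i j n).reverse = alternatingWord j i n := by
    intro i j n
    induction n generalizing i j with
    | zero => rfl
    | succ n ih => simp [altList, alternatingWord, ih]
  have h1 := cs.wordProd_braidWord_eq i j
  rw [braidWord, braidWord, ← h, ← h, wordProd_reverse, wordProd_reverse, M.symmetric j i] at h1
  exact (inv_injective h1).symm

end Dihedral
end CoxeterSystem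
namespace CoxeterSystem

section PathWeight

variable (cs : CoxeterSystem M W) {F : Type*} [Field F] (a b : B → W → F)

open scoped Classical in
/-- The coefficient of `y` after the letters of a word act successively on `w`, each letter `i`
sending `w` to `a i w` times `w` plus `b i w` times `w * cs.simple i`. -/
noncomputable def pathCoeff : List B → W → W → F
  | [], w, y => if w = y then 1 else 0
  | i :: ω, w, y => a i w * pathCoeff ω w y + b i w * pathCoeff ω (w * cs.simple i) y

/-- The product of the coefficients `b` along the path from `w` described by a word. -/
noncomputable def pathWeight : List B → W → F
  | [], _ => 1
  | i :: ω, w => b i w * pathWeight ω (w * cs.simple i)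

theorem pathWeight_append (ω ω' : List B) (w : W) :
    cs.pathWeight b (ω ++ ω') w =
      cs.pathWeight b ω w * cs.pathWeight b ω' (w * cs.wordProd ω) := by
  induction ω generalizing w with
  | nil => simp [pathWeight]
  | cons i ω ih => simp [pathWeight, ih, wordProd_cons, mul_assoc]

theorem pathCoeff_eq_zero {ω : List B} {w y : W} (h : ω.length < cs.length (w⁻¹ * y)) :
    cs.pathCoeff a b ω w y = 0 := by
  induction ω generalizing w with
  | nil =>
    rw [pathCoeff, if_neg]
    rintro rfl
    simp at h
  | cons i ω ih =>
    rw [List.length_cons] at h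
    rw [pathCoeff, ih (by lia), ih, mul_zero, mul_zero, add_zero]
    rw [mul_inv_rev, inv_simple, mul_assoc]
    have := cs.length_simple_mul (w⁻¹ * y) i
    lia

theorem IsReduced.of_cons {cs : CoxeterSystem M W} {i : B} {ω : List B}
    (h : cs.IsReduced (i :: ω)) : cs.IsReduced ω := by
  simpa using h.drop 1

theorem pathCoeff_wordProd {ω : List B} (hω : cs.IsReduced ω) (w : W) :
    cs.pathCoeff a b ω w (w * cs.wordProd ω) = cs.pathWeight b ω w := by
  induction ω generalizing w with
  | nil => simp [pathCoeff, pathWeight]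
  | cons i ω ih =>
    have h := ih hω.of_cons (w * cs.simple i)
    rw [mul_assoc, ← wordProd_cons] at h
    rw [pathCoeff, pathWeight, h, pathCoeff_eq_zero, mul_zero, zero_add]
    rw [inv_mul_cancel_left, hω.eq]
    simp

theorem pathCoeff_concat (ω : List B) (i : B) (w y : W) :
    cs.pathCoeff a b (ω ++ [i]) w y =
      cs.pathCoeff a b ω w y * a i y +
        cs.pathCoeff a b ω w (y * cs.simple i) * b i (y * cs.simple i) := by
  induction ω generalizing w with
  | nil =>
    have h : w * cs.simple i = y ↔ w = y * cs.simple i :=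
      ⟨fun h ↦ by simp [← h], fun h ↦ by simp [h]⟩
    simp only [List.nil_append, pathCoeff, h]
    split_ifs with h1 h2 h2 <;> simp_all
  | cons j ω ih =>
    rw [List.cons_append, pathCoeff, ih, ih, pathCoeff, pathCoeff]
    ring

end PathWeight

end CoxeterSystem

theorem altProd_succ' {E : Type*} [Monoid E] (x y : E) (n : ℕ) :
    altProd x y (n + 1) = altProd x y n * if Even n then x else y := by
  induction n generalizing x y with
  | zero => simp [altProd]
  | succ n ih =>
    rw [altProd, ih y x, altProd, mul_assoc]
    by_cases h : Even n <;> simp [h, Nat.even_add_one]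

namespace AYMap

variable {cs : CoxeterSystem M W} {F : Type*} [Field F] {K : Set W} (P : AYMap cs F K)

/-- The operator of a word, the first letter acting first. -/
noncomputable def wordOp : List B → Module.End F (↥K →₀ F)
  | [] => 1
  | i :: ω => wordOp ω * P.ρ i

theorem wordOp_Cvec (ω : List B) {w : W} (hw : w ∈ K) (y : W) :
    Finsupp.lmapDomain F F Subtype.val (P.wordOp ω (Cvec F K w hw)) y =
      cs.pathCoeff P.a P.b ω w y := by
  classical
  induction ω generalizing w with
  | nil => simp [wordOp, Cvec, pathCoeff, Finsupp.single_apply]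
  | cons i ω ih =>
    rw [wordOp, Module.End.mul_apply, pathCoeff]
    by_cases h : w * cs.simple i ∈ K
    · rw [P.axiomA_mem i w hw h]
      simp only [map_add, map_smul, Finsupp.add_apply, Finsupp.smul_apply, smul_eq_mul, ih]
    · rw [P.axiomA_not_mem i w hw h, P.b_eq_zero i w hw h]
      simp only [map_smul, Finsupp.smul_apply, smul_eq_mul, ih, zero_mul, add_zero]

theorem wordOp_altList (i j : B) (n : ℕ) :
    P.wordOp (altList i j n) =
      if Even n then altProd (P.ρ j) (P.ρ i) n else altProd (P.ρ i) (P.ρ j) n := by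
  induction n generalizing i j with
  | zero => simp [wordOp, altList, altProd]
  | succ n ih =>
    rw [altList, wordOp, ih, altProd_succ', altProd_succ']
    by_cases h : Even n <;> simp [h, Nat.even_add_one]

theorem mem_of_b_ne_zero {i : B} {w : W} (hw : w ∈ K) (h : P.b i w ≠ 0) : w * cs.simple i ∈ K := by
  by_contra h'
  exact h (P.b_eq_zero i w hw h')

theorem mem_of_pathWeight_ne_zero {ω : List B} {w : W} (hw : w ∈ K)
    (h : cs.pathWeight P.b ω w ≠ 0) : w * cs.wordProd ω ∈ K := by
  induction ω generalizing w with
  | nil => simpa using hw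
  | cons i ω ih =>
    rw [pathWeight] at h
    rw [wordProd_cons, ← mul_assoc]
    exact ih (P.mem_of_b_ne_zero hw (left_ne_zero_of_mul h)) (right_ne_zero_of_mul h)

section Braid

variable {P}

theorem pathCoeff_altList_comm (hbraid : BraidRels M P.ρ)
    {i j : B} (hij : i ≠ j) (hm : M i j ≠ 0) {w : W} (hw : w ∈ K)
    (y : W) :
    cs.pathCoeff P.a P.b (altList i j (M i j)) w y =
      cs.pathCoeff P.a P.b (altList j i (M i j)) w y := by
  rw [← P.wordOp_Cvec _ hw, ← P.wordOp_Cvec _ hw, wordOp_altList, wordOp_altList,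
    hbraid i j hij hm]

theorem pathWeight_altList_comm (hbraid : BraidRels M P.ρ)
    {i j : B} (hij : i ≠ j) (hm : M i j ≠ 0) {w : W} (hw : w ∈ K) :
    cs.pathWeight P.b (altList i j (M i j)) w = cs.pathWeight P.b (altList j i (M i j)) w := by
  have h1 := cs.isReduced_altList hij (.inr le_rfl)
  have h2 := cs.isReduced_altList hij.symm (.inr (M.symmetric i j).le)
  rw [← cs.pathCoeff_wordProd P.a P.b h1, ← cs.pathCoeff_wordProd P.a P.b h2,
    pathCoeff_altList_comm hbraid hij hm hw, cs.wordProd_altList_eq]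

theorem pathWeight_eq_of_wordProd_eq (hbraid : BraidRels M P.ρ)
    {ω ω' : List B} (hω : cs.IsReduced ω) (hω' : cs.IsReduced ω')
    (h : cs.wordProd ω = cs.wordProd ω') {w : W} (hw : w ∈ K) :
    cs.pathWeight P.b ω w = cs.pathWeight P.b ω' w := by
  induction hn : ω.length using Nat.strong_induction_on generalizing ω ω' w with
  | _ n ih =>
  have hlen : ω.length = ω'.length := by rw [← hω.eq, ← hω'.eq, h]
  subst hn
  have tail : ∀ (i : B) (ξ ξ' : List B), cs.IsReduced (i :: ξ) → cs.IsReduced (i :: ξ') →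
      (i :: ξ).length = ω.length → cs.wordProd (i :: ξ) = cs.wordProd (i :: ξ') →
      cs.pathWeight P.b (i :: ξ) w = cs.pathWeight P.b (i :: ξ') w := by
    intro i ξ ξ' hξ hξ' hl heq
    rw [pathWeight, pathWeight]
    by_cases hb : P.b i w = 0
    · rw [hb, zero_mul, zero_mul]
    · rw [wordProd_cons, wordProd_cons] at heq
      rw [ih ξ.length (by simp [← hl]) hξ.of_cons hξ'.of_cons (mul_left_cancel heq)
        (P.mem_of_b_ne_zero hw hb) rfl]
  have descent : ∀ (i : B) (ξ : List B), cs.IsReduced (i :: ξ) →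
      cs.IsLeftDescent (cs.wordProd (i :: ξ)) i := by
    intro i ξ hξ
    rw [IsLeftDescent, hξ.eq, wordProd_cons, simple_mul_simple_cancel_left, hξ.of_cons.eq]
    simp
  match ω, ω' with
  | [], [] => rfl
  | [], _ :: _ => simp at hlen
  | _ :: _, [] => simp at hlen
  | i :: ξ, j :: ξ' =>
    rcases eq_or_ne i j with rfl | hij
    · exact tail i ξ ξ' hω hω' rfl h
    have hi := descent i ξ hω
    have hj := descent j ξ' hω'
    rw [← h] at hj
    have hm := cs.coxeterMatrix_ne_zero_of_isLeftDescent hij hi hj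
    obtain ⟨η, hη, hηr⟩ := cs.exists_altList_append (M i j) hij (.inr le_rfl) hi hj
    have hη' : cs.wordProd (i :: ξ) = cs.wordProd (altList j i (M i j) ++ η) := by
      rw [hη, wordProd_append, wordProd_append, wordProd_altList_eq]
    have hηr' : cs.IsReduced (altList j i (M i j) ++ η) := by
      have := hηr.eq
      rw [CoxeterSystem.IsReduced, ← hη', hη, this]
      simp
    have hswap : cs.pathWeight P.b (altList i j (M i j) ++ η) w =
        cs.pathWeight P.b (altList j i (M i j) ++ η) w := by
      rw [pathWeight_append, pathWeight_append, pathWeight_altList_comm hbraid hij hm hw,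
        wordProd_altList_eq]
    have h' := hη'.symm.trans h
    obtain ⟨k, hk⟩ := Nat.exists_eq_succ_of_ne_zero hm
    rw [hk] at hη hηr hη' hηr' hswap h'
    exact (tail i ξ _ hω hηr rfl hη).trans
      (hswap.trans (tail j _ ξ' hηr' hω' (by
        rw [hlen]; exact hηr'.eq.symm.trans ((congrArg cs.length h').trans hω'.eq)) h'))

theorem pathWeight_ne_zero (hbraid : BraidRels M P.ρ)
    (hmin : P.Minimal) {ω : List B} (hω : cs.IsReduced ω) {w : W}
    (hw : w ∈ K) (hwω : w * cs.wordProd ω ∈ K) : cs.pathWeight P.b ω w ≠ 0 := by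
  set K' : Set W :=
    {y | ∃ ξ, cs.IsReduced ξ ∧ y = w * cs.wordProd ξ ∧ cs.pathWeight P.b ξ w ≠ 0} with hK'
  have hsub : K' ⊆ K := by
    rintro _ ⟨ξ, -, rfl, hξ⟩
    exact P.mem_of_pathWeight_ne_zero hw hξ
  have hstep : ∀ (i : B) (y : W), y ∈ K' → P.b i y ≠ 0 → y * cs.simple i ∈ K' := by
    rintro i _ ⟨ξ, hξ, rfl, hne⟩ hb
    by_cases hd : cs.IsRightDescent (cs.wordProd ξ) i
    · obtain ⟨ξ', hξ', h⟩ := cs.exists_isReduced (cs.wordProd ξ * cs.simple i)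
      have h1 : cs.wordProd ξ = cs.wordProd (ξ' ++ [i]) := by
        rw [wordProd_append, ← h]
        simp
      have h2 : cs.IsReduced (ξ' ++ [i]) := by
        have h3 := cs.isRightDescent_iff.1 hd
        rw [h, hξ'.eq] at h3
        rw [CoxeterSystem.IsReduced, ← h1, ← h3]
        simp
      rw [pathWeight_eq_of_wordProd_eq hbraid hξ h2 h1 hw, pathWeight_append] at hne
      exact ⟨ξ', hξ', by rw [mul_assoc, h], left_ne_zero_of_mul hne⟩
    · refine ⟨ξ ++ [i], ?_, ?_, ?_⟩
      · rw [CoxeterSystem.IsReduced, wordProd_append, wordProd_singleton,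
          cs.not_isRightDescent_iff.1 hd, hξ.eq]
        simp
      · simp [wordProd_append, mul_assoc]
      · rw [pathWeight_append]
        simp [pathWeight, hne, hb]
  have hinv : ∀ (i : B), ∀ x ∈ spanOf F K K', P.ρ i x ∈ spanOf F K K' := by
    intro i x hx
    induction hx using Submodule.span_induction with
    | mem x hx =>
      obtain ⟨y, hy, hy', rfl⟩ := hx
      have h1 : Cvec F K y hy ∈ spanOf F K K' := Submodule.subset_span ⟨y, hy, hy', rfl⟩
      by_cases hb : P.b i y = 0
      · by_cases h : y * cs.simple i ∈ K
        · rw [P.axiomA_mem i y hy h, hb, zero_smul, add_zero]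
          exact Submodule.smul_mem _ _ h1
        · rw [P.axiomA_not_mem i y hy h]
          exact Submodule.smul_mem _ _ h1
      · have h := P.mem_of_b_ne_zero hy hb
        rw [P.axiomA_mem i y hy h]
        exact add_mem (Submodule.smul_mem _ _ h1)
          (Submodule.smul_mem _ _ (Submodule.subset_span ⟨_, h, hstep i y hy' hb, rfl⟩))
    | zero => simp
    | add x y _ _ hx hy => rw [map_add]; exact add_mem hx hy
    | smul c x _ hx => rw [map_smul]; exact Submodule.smul_mem _ _ hx
  have hne : K'.Nonempty := ⟨w, [], by simp [CoxeterSystem.IsReduced], by simp, by simp [pathWeight]⟩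
  have hmem := hwω
  rw [← hmin.2 K' hsub hne hinv] at hmem
  obtain ⟨ξ, hξ, heq, hξw⟩ := hmem
  rwa [pathWeight_eq_of_wordProd_eq hbraid hω hξ (mul_left_cancel heq) hw]

theorem a_eq_of_pathWeight_altList_ne_zero (hbraid : BraidRels M P.ρ)
    {i j : B} (hij : i ≠ j) {n : ℕ} (hm : M i j = n + 1)
    {w : W} (hw : w ∈ K) (hne : cs.pathWeight P.b (altList j i n) w ≠ 0) :
    P.a i w = P.a (if Even n then j else i) (w * cs.wordProd (altList j i n)) := by
  have hsymm := M.symmetric i j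
  have hred := cs.isReduced_altList hij.symm (n := n) (by lia)
  have hcomm := pathCoeff_altList_comm hbraid hij (by lia) hw (w * cs.wordProd (altList j i n))
  have h1 := (cs.isReduced_altList hij (.inr le_rfl)).eq
  have h2 := (cs.isReduced_altList hij.symm (.inr hsymm.le)).eq
  rw [hm] at hcomm h1 h2
  rw [altList_succ' j i, pathCoeff_concat, altList, pathCoeff, cs.pathCoeff_wordProd _ _ hred,
    cs.pathCoeff_eq_zero (w := w * cs.simple i), cs.pathCoeff_eq_zero (ω := altList j i n),
    mul_zero, zero_mul, add_zero, add_zero, mul_comm] at hcomm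
  · exact mul_left_cancel₀ hne hcomm
  · rw [altList_succ', wordProd_append, wordProd_singleton] at h2
    rw [mul_assoc, inv_mul_cancel_left, h2]
    simp
  · rw [altList, wordProd_cons] at h1
    rw [mul_inv_rev, inv_simple, mul_assoc, inv_mul_cancel_left, h1]
    simp

theorem a_eq_of_simple_mul_eq (hbraid : BraidRels M P.ρ)
    (hmin : P.Minimal) {i i' : B} {w u : W} (hw : w ∈ K)
    (hwu : w * u ∈ K) (hu : cs.simple i * u = u * cs.simple i')
    (hlt : cs.length u < cs.length (cs.simple i * u)) : P.a i w = P.a i' (w * u) := by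
  induction hn : cs.length u using Nat.strong_induction_on generalizing i w u with
  | _ n ih =>
  subst hn
  rcases eq_or_ne u 1 with rfl | hu1
  · rw [mul_one, one_mul] at hu
    rw [cs.simple_injective hu, mul_one]
  obtain ⟨j, hj⟩ := cs.exists_leftDescent_of_ne_one hu1
  have hij : i ≠ j := by
    rintro rfl
    rw [IsLeftDescent] at hj
    lia
  have hi' : cs.IsLeftDescent (cs.simple i * u) i := by
    rwa [IsLeftDescent, simple_mul_simple_cancel_left]
  have hj' : cs.IsLeftDescent (cs.simple i * u) j := by
    rw [IsLeftDescent]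
    rw [hu] at hlt ⊢
    rw [IsLeftDescent] at hj
    rw [← mul_assoc]
    have := cs.length_mul_simple (cs.simple j * u) i'
    lia
  have hm := cs.coxeterMatrix_ne_zero_of_isLeftDescent hij hi' hj'
  obtain ⟨n, hn⟩ := Nat.exists_eq_succ_of_ne_zero hm
  have h2 : n ≠ 0 := by
    rintro rfl
    exact M.off_diagonal i j hij hn
  obtain ⟨ξ, hξ, hξr⟩ := cs.exists_altList_append (M i j) hij (.inr le_rfl) hi' hj'
  have hlen := hξr.eq
  have halt := cs.wordProd_altList_eq i j
  rw [hn] at hξ hξr hlen halt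
  rw [← hξ] at hlen
  have hred : cs.IsReduced (altList j i n ++ ξ) := CoxeterSystem.IsReduced.of_cons (i := i) hξr
  have hξred : cs.IsReduced ξ := by simpa using hred.drop n
  have hu' : u = cs.wordProd (altList j i n ++ ξ) := by
    rw [altList, List.cons_append, wordProd_cons] at hξ
    exact mul_left_cancel hξ
  have hne : cs.pathWeight P.b (altList j i n) w ≠ 0 := by
    have h := pathWeight_ne_zero hbraid hmin hred hw (by rwa [← hu'])
    rw [pathWeight_append] at h
    exact left_ne_zero_of_mul h
  rw [a_eq_of_pathWeight_altList_ne_zero hbraid hij hn hw hne]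
  rw [altList_succ' j i, altList, wordProd_cons, wordProd_append, wordProd_singleton] at halt
  generalize (if Even n then j else i) = k at halt ⊢
  rw [wordProd_append] at hu'
  have hx : cs.simple k * cs.wordProd ξ = cs.wordProd ξ * cs.simple i' := by
    rw [hu', ← mul_assoc, halt, mul_assoc, mul_assoc] at hu
    exact mul_left_cancel hu
  have hlen' := hred.eq
  rw [wordProd_append, ← hu'] at hlen'
  have hlenξ := hξred.eq
  simp only [List.length_append, length_altList] at hlen hlen'
  rw [hu', ← mul_assoc] at hwu ⊢
  refine ih _ (by lia) (P.mem_of_pathWeight_ne_zero hw hne) hwu hx ?_ rfl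
  have h3 := cs.length_mul_le (cs.wordProd (altList j i n)) (cs.simple k * cs.wordProd ξ)
  rw [← mul_assoc, ← halt, mul_assoc, ← hu', hlen] at h3
  have h4 := cs.length_wordProd_le (altList j i n)
  rw [length_altList] at h4
  lia

theorem a_eq_of_invParity_eq (hbraid : BraidRels M P.ρ)
    (hmin : P.Minimal) {i i' : B} {w w' : W} (hw : w ∈ K) (hw' : w' ∈ K)
    (ht : w * cs.simple i * w⁻¹ = w' * cs.simple i' * w'⁻¹)
    (hpar : cs.invParity w⁻¹ (w * cs.simple i * w⁻¹) =
      cs.invParity w'⁻¹ (w * cs.simple i * w⁻¹)) :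
    P.a i w = P.a i' w' := by
  have hconj : cs.simple i * (w⁻¹ * w') = w⁻¹ * w' * cs.simple i' := by
    have h := congrArg (fun x ↦ w⁻¹ * x * w') ht
    simpa [mul_assoc] using h
  have hmul := cs.invParity_mul (w'⁻¹ * w) w⁻¹ (w * cs.simple i * w⁻¹)
  rw [mul_inv_cancel_right, hpar, left_eq_add] at hmul
  have h1 : w⁻¹ * (w * cs.simple i * w⁻¹) * w⁻¹⁻¹ = cs.simple i := by group
  rw [h1] at hmul
  have h2 := (cs.isReflection_simple i).invParity_eq_one_iff (w'⁻¹ * w)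
  rw [hmul] at h2
  have h3 : ¬ cs.IsLeftDescent (w⁻¹ * w') i := by
    rw [← isRightDescent_inv_iff, IsRightDescent, mul_inv_rev, inv_inv, ← h2]
    exact zero_ne_one
  have h4 := cs.not_isLeftDescent_iff.1 h3
  have h5 := a_eq_of_simple_mul_eq hbraid hmin hw (by simpa using hw') hconj (by lia)
  rwa [mul_inv_cancel_left] at h5

end Braid

theorem exists_extension {I X Y F : Type*} [Zero F]
    (p : I → X → Prop) (c : I → X → F) (r : I → X → Y)
    (h : ∀ i i' x x', p i x → p i' x' → r i x = r i' x' → c i x = c i' x') :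
    ∃ f : Y → F, ∀ i x, p i x → c i x = f (r i x) := by
  classical
  refine ⟨fun y ↦ if hy : ∃ q : I × X, p q.1 q.2 ∧ r q.1 q.2 = y
    then c hy.choose.1 hy.choose.2 else 0, fun i x hix ↦ ?_⟩
  have hy : ∃ q : I × X, p q.1 q.2 ∧ r q.1 q.2 = r i x := ⟨(i, x), hix, rfl⟩
  beta_reduce
  rw [dif_pos hy]
  exact h _ _ _ _ hix hy.choose_spec.1 hy.choose_spec.2.symm

end AYMap

/-- a minimal pair satisfying the braid relations and Axiom (A), whose
coefficients satisfy `a_s(w) = a_{s'}(w') ⟹ b_s(w) = b_{s'}(w')`, satisfies Axiom (B):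
the coefficients depend only on the reflection `w s w⁻¹` and on whether `ℓ(w) < ℓ(ws)`. -/
theorem stmt13 (cs : CoxeterSystem M W) (F : Type*) [Field F] (K : Set W)
    (P : AYMap cs F K)
    (hbraid : BraidRels M P.ρ)
    (hmin : P.Minimal)
    (hab : ∀ (i i' : B) (w w' : W), w ∈ K → w' ∈ K → P.a i w = P.a i' w' → P.b i w = P.b i' w') :
    ∃ ad aBar bd bBar : W → F, ∀ (i : B) (w : W), w ∈ K →
      (cs.length w < cs.length (w * cs.simple i) →
        P.a i w = ad (w * cs.simple i * w⁻¹) ∧ P.b i w = bd (w * cs.simple i * w⁻¹)) ∧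
      (cs.length (w * cs.simple i) < cs.length w →
        P.a i w = aBar (w * cs.simple i * w⁻¹) ∧ P.b i w = bBar (w * cs.simple i * w⁻¹)) := by
  have hlen : ∀ (i : B) (w : W), cs.invParity w⁻¹ (w * cs.simple i * w⁻¹) = 1 ↔
      cs.length (w * cs.simple i) < cs.length w := by
    intro i w
    rw [((cs.isReflection_simple i).conj w).invParity_eq_one_iff, length_inv, ← length_inv,
      mul_assoc w, inv_mul_cancel_left, mul_inv_rev, inv_simple, inv_inv]
  have hup : ∀ (i : B) (w : W), cs.length w < cs.length (w * cs.simple i) →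
      cs.invParity w⁻¹ (w * cs.simple i * w⁻¹) = 0 := by
    intro i w h
    have h1 := mt (hlen i w).1 (by lia)
    generalize cs.invParity w⁻¹ (w * cs.simple i * w⁻¹) = x at h1
    revert h1 x
    decide
  have ha : ∀ (i i' : B) (w w' : W) (ε : ZMod 2),
      (w ∈ K ∧ cs.invParity w⁻¹ (w * cs.simple i * w⁻¹) = ε) →
      (w' ∈ K ∧ cs.invParity w'⁻¹ (w' * cs.simple i' * w'⁻¹) = ε) →
      w * cs.simple i * w⁻¹ = w' * cs.simple i' * w'⁻¹ → P.a i w = P.a i' w' := by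
    rintro i i' w w' ε ⟨hw, h⟩ ⟨hw', h'⟩ ht
    exact AYMap.a_eq_of_invParity_eq hbraid hmin hw hw' ht (by rw [h, ht, h'])
  have hext : ∀ ε : ZMod 2, ∃ f g : W → F, ∀ (i : B) (w : W), w ∈ K →
      cs.invParity w⁻¹ (w * cs.simple i * w⁻¹) = ε →
      P.a i w = f (w * cs.simple i * w⁻¹) ∧ P.b i w = g (w * cs.simple i * w⁻¹) := by
    intro ε
    obtain ⟨f, hf⟩ := AYMap.exists_extension
      (fun i w ↦ w ∈ K ∧ cs.invParity w⁻¹ (w * cs.simple i * w⁻¹) = ε) P.a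
      (fun i w ↦ w * cs.simple i * w⁻¹) (fun i i' w w' h h' ht ↦ ha i i' w w' ε h h' ht)
    obtain ⟨g, hg⟩ := AYMap.exists_extension
      (fun i w ↦ w ∈ K ∧ cs.invParity w⁻¹ (w * cs.simple i * w⁻¹) = ε) P.b
      (fun i w ↦ w * cs.simple i * w⁻¹)
      (fun i i' w w' h h' ht ↦ hab i i' w w' h.1 h'.1 (ha i i' w w' ε h h' ht))
    exact ⟨f, g, fun i w hw h ↦ ⟨hf i w ⟨hw, h⟩, hg i w ⟨hw, h⟩⟩⟩
  obtain ⟨ad, bd, hd⟩ := hext 0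
  obtain ⟨aBar, bBar, hBar⟩ := hext 1
  exact ⟨ad, aBar, bd, bBar, fun i w hw ↦
    ⟨fun h ↦ hd i w hw (hup i w h), fun h ↦ hBar i w hw ((hlen i w).2 h)⟩⟩
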